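/- Let 𝒢 be a quasi-compact ample groupoid all of whose orbits have the same finite number of elements, and let 𝓡 be its orbit equivalence relation. Then the orbit space 𝒢⁰/𝓡 is compact, Hausdorff and totally disconnected, and the canonical projection q : 𝒢⁰ → 𝒢⁰/𝓡 is a local homeomorphism. -/

import Mathlib

universe u

/-- The algebraic operations of a groupoid (identified with its set of arrows):
a (partially meaningful) composition `gmul` and an inversion `ginv`.  The product
`gmul g h` is only required to behave like composition when `g` and `h` are
composable, i.e. when `src g = rng h`. -/
class GroupoidOps (G : Type u) where
  gmul : G → G → G
  ginv : G → G

namespace GroupoidOps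

variable {G : Type u} [GroupoidOps G]

/-- The source map `s g = g⁻¹ g`. -/
def src (g : G) : G := gmul (ginv g) g

/-- The range map `r g = g g⁻¹`. -/
def rng (g : G) : G := gmul g (ginv g)

/-- The unit space `𝒢⁰`: the set of identity arrows. -/
def unitSpace (G : Type u) [GroupoidOps G] : Set G := {x : G | src x = x}

end GroupoidOps

open GroupoidOps

/-- A topological groupoid: a groupoid `G`, identified with its arrow space, equipped
with a topology such that inversion is continuous and composition is continuous on the
set of composable pairs. -/
class TopologicalGroupoid (G : Type u) extends TopologicalSpace G, GroupoidOps G where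
  ginv_ginv : ∀ g : G, ginv (ginv g) = g
  gmul_src : ∀ g : G, gmul g (src g) = g
  rng_gmul : ∀ g : G, gmul (rng g) g = g
  gmul_assoc : ∀ g h k : G, src g = rng h → src h = rng k →
    gmul (gmul g h) k = gmul g (gmul h k)
  src_gmul : ∀ g h : G, src g = rng h → src (gmul g h) = src h
  rng_gmul_comp : ∀ g h : G, src g = rng h → rng (gmul g h) = rng g
  ginv_gmul : ∀ g h : G, src g = rng h → ginv (gmul g h) = gmul (ginv h) (ginv g)
  ginv_unit : ∀ x : G, src x = x → ginv x = x
  src_src : ∀ g : G, src (src g) = src g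
  src_rng : ∀ g : G, src (rng g) = rng g
  continuous_ginv : Continuous (ginv : G → G)
  continuous_gmul : Continuous fun p : {p : G × G // src p.1 = rng p.2} => gmul p.1.1 p.1.2

/-- An ample groupoid: a topological groupoid (not necessarily Hausdorff) whose unit
space is locally compact, Hausdorff and totally disconnected in the subspace topology,
and whose source map, viewed as a map `G → 𝒢⁰`, is a local homeomorphism. -/
class AmpleGroupoid (G : Type u) extends TopologicalGroupoid G where
  t2_unitSpace : T2Space (unitSpace G)
  locallyCompact_unitSpace : LocallyCompactSpace (unitSpace G)
  totallyDisconnected_unitSpace : TotallyDisconnectedSpace (unitSpace G)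
  isLocalHomeomorph_src :
    IsLocalHomeomorph fun g : G => (⟨src g, TopologicalGroupoid.src_src g⟩ : unitSpace G)

namespace TopologicalGroupoid

variable {G : Type u} [TopologicalGroupoid G]

/-- A bisection: an open subset on which both the source and the range map are injective. -/
def IsBisection (U : Set G) : Prop :=
  IsOpen U ∧ Set.InjOn (src : G → G) U ∧ Set.InjOn (rng : G → G) U

/-- A compact bisection: a bisection which is compact
(quasi-compact and Hausdorff in the subspace topology). -/
def IsCompactBisection (U : Set G) : Prop :=
  IsBisection U ∧ IsCompact U ∧ T2Space U

/-- Setwise inverse `U⁻¹ = { u⁻¹ : u ∈ U }`. -/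
def setInv (U : Set G) : Set G := ginv '' U

/-- Setwise product `UV = { uv : u ∈ U, v ∈ V, s(u) = r(v) }`. -/
def setMul (U V : Set G) : Set G :=
  {x : G | ∃ u ∈ U, ∃ v ∈ V, src u = rng v ∧ x = gmul u v}

/-- A subgroupoid: a subset closed under inversion and (composable) composition. -/
def IsSubgroupoid (H : Set G) : Prop :=
  (∀ g ∈ H, ginv g ∈ H) ∧ ∀ g ∈ H, ∀ h ∈ H, src g = rng h → gmul g h ∈ H

/-- A groupoid is principal if every isotropy element is a unit. -/
def IsPrincipal (G : Type u) [TopologicalGroupoid G] : Prop :=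
  ∀ g : G, src g = rng g → g ∈ unitSpace G

/-- The orbit of `x`, namely `r(s⁻¹(x))`. -/
def orbit (x : G) : Set G := {y : G | ∃ g : G, src g = x ∧ rng g = y}

/-- A subset of the unit space is invariant if it is a union of orbits. -/
def IsInvariant (U : Set G) : Prop := ∀ g : G, src g ∈ U → rng g ∈ U

/-- An inverse semigroup of compact bisections: a nonempty collection of compact
bisections closed under setwise product and setwise inverse. -/
def IsInvSemigroupOfCompactBisections (S : Set (Set G)) : Prop :=
  S.Nonempty ∧ (∀ U ∈ S, IsCompactBisection U) ∧
    (∀ U ∈ S, setInv U ∈ S) ∧ ∀ U ∈ S, ∀ V ∈ S, setMul U V ∈ S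

/-- The orbit equivalence relation `𝓡` on the unit space. -/
def orbitRel (G : Type u) [TopologicalGroupoid G] :
    unitSpace G → unitSpace G → Prop :=
  fun x y => ∃ g : G, src g = (x : G) ∧ rng g = (y : G)

end TopologicalGroupoid

open TopologicalGroupoid

open Topology in
/-- Near `x`, every class of an open equivalence relation meets each member of a family of
neighbourhoods of the points of the finite class of `x`. -/
theorem eventually_class_meets_nhds {X : Type*} [TopologicalSpace X] {r : X → X → Prop}
    (hr : Equivalence r) (hq : IsOpenMap (Quot.mk r)) {x : X} (hfin : {y | r x y}.Finite)
    {V : X → Set X} (hV : ∀ a, a ∈ V a ∧ IsOpen (V a)) :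
    ∀ᶠ z in 𝓝 x, ∀ a, r x a → ∃ b ∈ V a, r z b := by
  have key : ∀ a ∈ {y | r x y}, ∀ᶠ z in 𝓝 x, ∃ b ∈ V a, r z b := by
    intro a ha
    have ho : IsOpen (Quot.mk r ⁻¹' (Quot.mk r '' V a)) :=
      (hq _ (hV a).2).preimage continuous_quot_mk
    filter_upwards [ho.mem_nhds ⟨a, (hV a).1, Quot.sound (hr.symm ha)⟩] with z hz
    obtain ⟨b, hb, hbz⟩ := hz
    exact ⟨b, hb, hr.symm (hr.quot_mk_eq_iff b z |>.1 hbz)⟩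
  exact (Filter.eventually_all_finite hfin).2 key

/-- If the class of `z` has the same finite number of elements as the class of `x` and meets all
members of a disjoint family indexed by the latter, then it has exactly one point in each of them
and no other points. -/
theorem exists_section_of_ncard_class_eq {X : Type*} {r : X → X → Prop} {x z : X}
    (hfin : {y | r z y}.Finite) (hcard : {y | r z y}.ncard = {y | r x y}.ncard)
    {V : X → Set X} (hdisj : {y | r x y}.PairwiseDisjoint V)
    (hmeet : ∀ a, r x a → ∃ b ∈ V a, r z b) :
    ∃ f : X → X, (∀ a, r x a → f a ∈ V a) ∧ ∀ w, r z w → ∃ a, r x a ∧ f a = w := by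
  choose! f hfV hfz using hmeet
  have hinj : Set.InjOn f {y | r x y} := by
    intro a ha b hb hab
    exact hdisj.elim_set ha hb (f a) (hfV a ha) (hab ▸ hfV b hb)
  have himage : f '' {y | r x y} = {y | r z y} := by
    apply Set.eq_of_subset_of_ncard_le _ _ hfin
    · rintro _ ⟨a, ha, rfl⟩
      exact hfz a ha
    · rw [hinj.ncard_image, hcard]
  refine ⟨f, hfV, fun w hw => ?_⟩
  have hw' : w ∈ f '' {y | r x y} := himage ▸ hw
  exact hw'

section EqualClassSizes

variable {X : Type*} [TopologicalSpace X] {r : X → X → Prop} {n : ℕ}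

theorem isLocallyInjective_quot_mk_of_ncard_class_eq [T2Space X] (hr : Equivalence r)
    (hq : IsOpenMap (Quot.mk r)) (hfin : ∀ x, {y | r x y}.Finite)
    (hcard : ∀ x, {y | r x y}.ncard = n) : IsLocallyInjective (Quot.mk r) := by
  rw [isLocallyInjective_iff_nhds]
  intro x
  obtain ⟨V, hV, hdisj⟩ := (hfin x).t2_separation
  refine ⟨_, Filter.inter_mem (eventually_class_meets_nhds hr hq (hfin x) hV)
    ((hV x).2.mem_nhds (hV x).1), ?_⟩
  rintro z ⟨hz, hzx⟩ w ⟨-, hwx⟩ hzw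
  obtain ⟨f, hfV, hf⟩ := exists_section_of_ncard_class_eq (hfin z)
    ((hcard z).trans (hcard x).symm) hdisj hz
  have unique : ∀ w, r z w → w ∈ V x → w = f x := by
    intro w hw hwx
    obtain ⟨a, ha, rfl⟩ := hf w hw
    rw [hdisj.elim_set ha (hr.refl x) (f a) (hfV a ha) hwx]
  rw [unique z (hr.refl z) hzx, unique w ((hr.quot_mk_eq_iff z w).1 hzw) hwx]

theorem t2Space_quot_of_ncard_class_eq [T2Space X] (hr : Equivalence r)
    (hq : IsOpenMap (Quot.mk r)) (hfin : ∀ x, {y | r x y}.Finite)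
    (hcard : ∀ x, {y | r x y}.ncard = n) : T2Space (Quot r) := by
  refine ⟨?_⟩
  rintro ⟨x⟩ ⟨y⟩ hxy
  obtain ⟨V, hV, hdisj⟩ := ((hfin x).union (hfin y)).t2_separation
  obtain ⟨A, hA, hAo, hxA⟩ := mem_nhds_iff.1 (eventually_class_meets_nhds hr hq (hfin x) hV)
  obtain ⟨B, hB, hBo, hyB⟩ := mem_nhds_iff.1 (eventually_class_meets_nhds hr hq (hfin y) hV)
  refine ⟨_, _, hq A hAo, hq B hBo, ⟨x, hxA, rfl⟩, ⟨y, hyB, rfl⟩, ?_⟩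
  rw [Set.disjoint_left]
  rintro _ ⟨z, hz, rfl⟩ ⟨w, hw, hwz⟩
  obtain ⟨f, hfV, hf⟩ := exists_section_of_ncard_class_eq (hfin z)
    ((hcard z).trans (hcard x).symm) (hdisj.subset Set.subset_union_left) (hA hz)
  obtain ⟨g, hgV, hg⟩ := exists_section_of_ncard_class_eq (hfin w)
    ((hcard w).trans (hcard y).symm) (hdisj.subset Set.subset_union_right) (hB hw)
  obtain ⟨a, ha, haz⟩ := hf z (hr.refl z)
  obtain ⟨b, hb, hbz⟩ := hg z ((hr.quot_mk_eq_iff w z).1 hwz)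
  have hab : a = b := hdisj.elim_set (Or.inl ha) (Or.inr hb) z (haz ▸ hfV a ha) (hbz ▸ hgV b hb)
  exact hxy (Quot.sound (hr.trans ha (hab ▸ hr.symm hb)))

end EqualClassSizes

theorem IsLocallyInjective.isLocalHomeomorph {X Y : Type*} [TopologicalSpace X]
    [TopologicalSpace Y] {f : X → Y} (hinj : IsLocallyInjective f) (hcont : Continuous f)
    (hopen : IsOpenMap f) : IsLocalHomeomorph f := by
  rw [isLocalHomeomorph_iff_isOpenEmbedding_restrict]
  intro x
  obtain ⟨U, hUo, hxU, hU⟩ := hinj x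
  exact ⟨U, hUo.mem_nhds hxU, .of_continuous_injective_isOpenMap
    (hcont.comp continuous_subtype_val) (Set.injOn_iff_injective.1 hU) (hopen.domRestrict hUo)⟩

theorem IsOpenMap.totallyDisconnectedSpace_of_surjective {X Y : Type*} [TopologicalSpace X]
    [TopologicalSpace Y] [CompactSpace X] [T2Space X] [TotallyDisconnectedSpace X] [T2Space Y]
    {f : X → Y} (hopen : IsOpenMap f) (hcont : Continuous f) (hsurj : Function.Surjective f) :
    TotallyDisconnectedSpace Y := by
  have : TotallySeparatedSpace Y := by
    rw [totallySeparatedSpace_iff_exists_isClopen]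
    intro a b hab
    obtain ⟨x, rfl⟩ := hsurj a
    obtain ⟨V, hV, hxV, hVb⟩ := compact_exists_isClopen_in_isOpen
      (isOpen_compl_singleton.preimage hcont : IsOpen (f ⁻¹' {b}ᶜ)) hab
    refine ⟨f '' V, ⟨(hV.isClosed.isCompact.image hcont).isClosed, hopen V hV.isOpen⟩,
      ⟨x, hxV, rfl⟩, ?_⟩
    rintro ⟨y, hy, rfl⟩
    exact hVb hy rfl
  infer_instance

namespace TopologicalGroupoid

section

variable {G : Type u} [TopologicalGroupoid G]

theorem src_ginv (g : G) : src (ginv g) = rng g := by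
  simp only [src, rng, ginv_ginv]

theorem rng_ginv (g : G) : rng (ginv g) = src g := by
  simp only [src, rng, ginv_ginv]

theorem rng_of_src_eq {x : G} (hx : src x = x) : rng x = x := by
  rw [← src_ginv, ginv_unit x hx, hx]

theorem orbitRel_equivalence : Equivalence (orbitRel G) where
  refl x := ⟨x, x.2, rng_of_src_eq x.2⟩
  symm := by
    rintro x y ⟨g, hx, hy⟩
    exact ⟨ginv g, (src_ginv g).trans hy, (rng_ginv g).trans hx⟩
  trans := by
    rintro x y z ⟨g, hgx, hgy⟩ ⟨h, hhy, hhz⟩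
    have hc : src h = rng g := hhy.trans hgy.symm
    exact ⟨gmul h g, (src_gmul h g hc).trans hgx, (rng_gmul_comp h g hc).trans hhz⟩

theorem image_orbitRel (x : unitSpace G) :
    Subtype.val '' {y | orbitRel G x y} = orbit (x : G) := by
  ext y
  constructor
  · rintro ⟨y, hy, rfl⟩
    exact hy
  · rintro ⟨g, hg, rfl⟩
    exact ⟨⟨rng g, src_rng g⟩, ⟨g, hg, rfl⟩, rfl⟩

end

theorem isOpenMap_quot_mk_orbitRel (G : Type u) [AmpleGroupoid G] :
    IsOpenMap (Quot.mk (orbitRel G)) := by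
  intro U hU
  let s : G → unitSpace G := fun g => ⟨src g, src_src g⟩
  have hs : IsLocalHomeomorph s := AmpleGroupoid.isLocalHomeomorph_src
  suffices h : Quot.mk (orbitRel G) ⁻¹' (Quot.mk (orbitRel G) '' U) =
      s '' (ginv ⁻¹' (s ⁻¹' U)) by
    rw [← isQuotientMap_quot_mk.isOpen_preimage, h]
    exact hs.isOpenMap _ ((hU.preimage hs.continuous).preimage continuous_ginv)
  ext y
  constructor
  · rintro ⟨x, hx, hxy⟩
    obtain ⟨g, hgy, hgx⟩ :=
      orbitRel_equivalence.symm ((orbitRel_equivalence.quot_mk_eq_iff x y).1 hxy)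
    refine ⟨g, ?_, Subtype.ext hgy⟩
    have : s (ginv g) = x := Subtype.ext ((src_ginv g).trans hgx)
    exact (this ▸ hx : s (ginv g) ∈ U)
  · rintro ⟨g, hg, rfl⟩
    exact ⟨_, hg, Quot.sound ⟨ginv g, rfl, rng_ginv g⟩⟩

end TopologicalGroupoid

/-- Let `𝒢` be a quasi-compact ample groupoid all of whose orbits
have the same finite number of elements, with orbit equivalence relation `𝓡`.  Then
the orbit space `𝒢⁰/𝓡` is compact, Hausdorff and totally disconnected, and the
canonical projection `q : 𝒢⁰ → 𝒢⁰/𝓡` is a local homeomorphism. -/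
theorem orbit_space_equal_orbit_sizes (G : Type u) [AmpleGroupoid G]
    [CompactSpace G] (n : ℕ)
    (horb : ∀ x ∈ unitSpace G, (orbit x).Finite ∧ (orbit x).ncard = n) :
    (CompactSpace (Quot (orbitRel G)) ∧ T2Space (Quot (orbitRel G)) ∧
      TotallyDisconnectedSpace (Quot (orbitRel G))) ∧
    IsLocalHomeomorph (Quot.mk (orbitRel G)) := by
  have := AmpleGroupoid.t2_unitSpace (G := G)
  have := AmpleGroupoid.totallyDisconnected_unitSpace (G := G)
  have hsurj : Function.Surjective
      fun g : G => (⟨src g, TopologicalGroupoid.src_src g⟩ : unitSpace G) :=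
    fun x => ⟨x, Subtype.ext x.2⟩
  have : CompactSpace (unitSpace G) :=
    hsurj.compactSpace AmpleGroupoid.isLocalHomeomorph_src.continuous
  have hopen := isOpenMap_quot_mk_orbitRel G
  have hfin : ∀ x, {y | orbitRel G x y}.Finite := by
    intro x
    apply Set.Finite.of_finite_image _ Subtype.val_injective.injOn
    rw [image_orbitRel]
    exact (horb x x.2).1
  have hcard : ∀ x, {y | orbitRel G x y}.ncard = n := by
    intro x
    rw [← Set.ncard_image_of_injective _ Subtype.val_injective, image_orbitRel]
    exact (horb x x.2).2
  have hT2 : T2Space (Quot (orbitRel G)) :=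
    t2Space_quot_of_ncard_class_eq orbitRel_equivalence hopen hfin hcard
  exact ⟨⟨inferInstance, hT2,
    hopen.totallyDisconnectedSpace_of_surjective continuous_quot_mk Quot.mk_surjective⟩,
    (isLocallyInjective_quot_mk_of_ncard_class_eq orbitRel_equivalence hopen hfin
      hcard).isLocalHomeomorph continuous_quot_mk hopen⟩
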